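/- arXiv:2410.06707 — 5 statements merged into one kernel-verified Lean document; each statement's English description precedes it below -/
import Mathlib

section
/- Let K ≥ 2 and let p : Fin K → ℝ be a probability vector (0 ≤ p i for all i and ∑ i, p i = 1). Let q = softmax(p), i.e. q i = exp(p i) / ∑ j, exp(p j). Then for every i, 1/(K - 1 + e) ≤ q i ≤ e/(K - 1 + e), and moreover 0 < 1/(K - 1 + e) and e/(K - 1 + e) < 1, where e = exp 1. -/
noncomputable def softmax {K : ℕ} (z : Fin K → ℝ) : Fin K → ℝ :=
  fun i => Real.exp (z i) / ∑ j, Real.exp (z j)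

/-- On the unit interval the exponential lies below its chord. -/
theorem Real.exp_le_chord {x : ℝ} (h₀ : 0 ≤ x) (h₁ : x ≤ 1) :
    Real.exp x ≤ 1 + (Real.exp 1 - 1) * x := by
  have h := convexOn_exp.2 (Set.mem_univ 0) (Set.mem_univ 1) (sub_nonneg.2 h₁) h₀
    (sub_add_cancel 1 x)
  simp only [smul_eq_mul, mul_zero, mul_one, zero_add, Real.exp_zero] at h
  linarith

theorem resoftmax_bounds (K : ℕ) (hK : 2 ≤ K) (p : Fin K → ℝ)
    (hp : ∀ i, 0 ≤ p i) (hsum : ∑ i, p i = 1) :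
    (∀ i, 1 / ((K : ℝ) - 1 + Real.exp 1) ≤ softmax p i ∧
      softmax p i ≤ Real.exp 1 / ((K : ℝ) - 1 + Real.exp 1)) ∧
    0 < 1 / ((K : ℝ) - 1 + Real.exp 1) ∧
    Real.exp 1 / ((K : ℝ) - 1 + Real.exp 1) < 1 := by
  have hK' : (2 : ℝ) ≤ K := by exact_mod_cast hK
  have hD : 0 < (K : ℝ) - 1 + Real.exp 1 := by linarith [Real.exp_pos 1]
  have hp_le : ∀ i, p i ≤ 1 := fun i =>
    hsum ▸ Finset.single_le_sum (fun j _ => hp j) (Finset.mem_univ i)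
  refine ⟨fun i => ?_, by positivity, (div_lt_one hD).2 (by linarith)⟩
  have hS : 0 < ∑ j, Real.exp (p j) :=
    Finset.sum_pos (fun j _ => Real.exp_pos _) ⟨i, Finset.mem_univ i⟩
  have h_one_le : ∀ j, 1 ≤ Real.exp (p j) := fun j => Real.one_le_exp (hp j)
  constructor
  · have h_upper : ∑ j, Real.exp (p j) ≤ (K : ℝ) - 1 + Real.exp 1 := by
      calc ∑ j, Real.exp (p j) ≤ ∑ j, (1 + (Real.exp 1 - 1) * p j) :=
            Finset.sum_le_sum fun j _ => Real.exp_le_chord (hp j) (hp_le j)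
        _ = (K : ℝ) - 1 + Real.exp 1 := by
            rw [Finset.sum_add_distrib, ← Finset.mul_sum, hsum]
            simp
            ring
    exact div_le_div₀ (Real.exp_pos _).le (h_one_le i) hS h_upper
  · have h_lower : Real.exp (p i) - 1 ≤ ∑ j, (Real.exp (p j) - 1) :=
      Finset.single_le_sum (f := fun j => Real.exp (p j) - 1)
        (fun j _ => sub_nonneg.2 (h_one_le j)) (Finset.mem_univ i)
    rw [Finset.sum_sub_distrib] at h_lower
    simp only [Finset.sum_const, Finset.card_univ, Fintype.card_fin, nsmul_eq_mul, mul_one]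
      at h_lower
    have h_exp : Real.exp (p i) ≤ Real.exp 1 := Real.exp_le_exp.2 (hp_le i)
    refine (div_le_div_iff₀ hS hD).2 ?_
    calc Real.exp (p i) * ((K : ℝ) - 1 + Real.exp 1)
        ≤ Real.exp 1 * (Real.exp (p i) + ((K : ℝ) - 1)) := by
          linarith [mul_le_mul_of_nonneg_right h_exp (show 0 ≤ (K : ℝ) - 1 by linarith)]
      _ ≤ Real.exp 1 * ∑ j, Real.exp (p j) :=
          mul_le_mul_of_nonneg_left (by linarith) (Real.exp_pos 1).le
end

section
/- Let K ≥ 2 and let p : Fin K → ℝ be a probability vector (0 ≤ p i, ∑ i, p i = 1) that is not constant (there exist i, j with p i ≠ p j). Let q = softmax(p). Suppose τ_p > 0 and τ_q > 0 satisfy softmax(fun i => p i / τ_p) = softmax(fun i => q i / τ_q) (equality as functions Fin K → ℝ). Then τ_q < τ_p. -/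
theorem sum_exp_pos {K : ℕ} (z : Fin K → ℝ) (i : Fin K) : 0 < ∑ j, Real.exp (z j) :=
  Finset.sum_pos (fun j _ => Real.exp_pos (z j)) ⟨i, Finset.mem_univ i⟩

/-- Vectors with equal softmax differ by a constant. -/
theorem sub_eq_sub_of_softmax_eq {K : ℕ} {x y : Fin K → ℝ} (h : softmax x = softmax y)
    (i j : Fin K) : x i - x j = y i - y j := by
  have hx := sum_exp_pos x i
  have hy := sum_exp_pos y i
  have key : ∀ k, x k - Real.log (∑ l, Real.exp (x l)) =
      y k - Real.log (∑ l, Real.exp (y l)) := by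
    intro k
    have hk := congrArg Real.log (congrFun h k)
    simp only [softmax] at hk
    rwa [Real.log_div (Real.exp_ne_zero _) hx.ne', Real.log_div (Real.exp_ne_zero _) hy.ne',
      Real.log_exp, Real.log_exp] at hk
  linarith [key i, key j]

/-- Softmax strictly contracts the gap between two distinct coordinates. -/
theorem softmax_sub_lt {K : ℕ} (z : Fin K → ℝ) {i j : Fin K} (h : z j < z i) :
    softmax z i - softmax z j < z i - z j := by
  have hS := sum_exp_pos z i
  have hle : Real.exp (z i) ≤ ∑ k, Real.exp (z k) :=
    Finset.single_le_sum (f := fun k => Real.exp (z k))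
      (fun k _ => (Real.exp_pos (z k)).le) (Finset.mem_univ i)
  have htangent : z j - z i + 1 < Real.exp (z j - z i) :=
    Real.add_one_lt_exp (sub_ne_zero.mpr h.ne)
  have hmul : Real.exp (z j) = Real.exp (z i) * Real.exp (z j - z i) := by
    rw [← Real.exp_add]; congr 1; ring
  simp only [softmax]
  rw [← sub_div, div_lt_iff₀ hS]
  calc Real.exp (z i) - Real.exp (z j) < Real.exp (z i) * (z i - z j) := by
        nlinarith [mul_lt_mul_of_pos_left htangent (Real.exp_pos (z i))]
    _ ≤ (∑ k, Real.exp (z k)) * (z i - z j) :=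
        mul_le_mul_of_nonneg_right hle (sub_pos.mpr h).le
    _ = (z i - z j) * ∑ k, Real.exp (z k) := mul_comm _ _

theorem temp_of_resoftmax_lt (K : ℕ) (hK : 2 ≤ K) (p : Fin K → ℝ)
    (hp : ∀ i, 0 ≤ p i) (hsum : ∑ i, p i = 1)
    (hnc : ∃ i j, p i ≠ p j)
    (q : Fin K → ℝ) (hq : q = softmax p)
    (τp τq : ℝ) (hτp : 0 < τp) (hτq : 0 < τq)
    (hcal : softmax (fun i => p i / τp) = softmax (fun i => q i / τq)) :
    τq < τp := by
  obtain ⟨i, j, hji⟩ : ∃ i j, p j < p i := by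
    obtain ⟨i, j, hij⟩ := hnc
    rcases lt_or_gt_of_ne hij with h | h
    exacts [⟨j, i, h⟩, ⟨i, j, h⟩]
  have hlt : q i - q j < p i - p j := hq ▸ softmax_sub_lt p hji
  have hgap : (p i - p j) / τp = (q i - q j) / τq := by
    simpa only [sub_div] using sub_eq_sub_of_softmax_eq hcal i j
  rw [div_eq_div_iff hτp.ne' hτq.ne'] at hgap
  have hpos : 0 < p i - p j := sub_pos.mpr hji
  refine lt_of_mul_lt_mul_left ?_ hpos.le
  rw [hgap]
  exact mul_lt_mul_of_pos_right hlt hτp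
end

section
/- Let K ≥ 2, let p : Fin K → ℝ be a probability vector (0 ≤ p i, ∑ i, p i = 1), and let q = softmax(p). If p i > p j, then 0 < q i - q j < p i - p j. -/
theorem exp_sub_exp_lt_mul_exp {a b : ℝ} (h : b < a) :
    Real.exp a - Real.exp b < (a - b) * Real.exp a := by
  have h₁ : b - a + 1 < Real.exp (b - a) := Real.add_one_lt_exp (sub_neg.mpr h).ne
  have h₂ : Real.exp b = Real.exp (b - a) * Real.exp a := by
    rw [← Real.exp_add, sub_add_cancel]
  nlinarith [mul_lt_mul_of_pos_right h₁ (Real.exp_pos a)]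

theorem resoftmax_gap_contraction (K : ℕ) (hK : 2 ≤ K) (p : Fin K → ℝ)
    (hp : ∀ i, 0 ≤ p i) (hsum : ∑ i, p i = 1)
    (q : Fin K → ℝ) (hq : q = softmax p)
    (i j : Fin K) (hij : p i > p j) :
    0 < q i - q j ∧ q i - q j < p i - p j := by
  subst hq
  have hle : Real.exp (p i) ≤ ∑ k, Real.exp (p k) :=
    Finset.single_le_sum (f := fun k => Real.exp (p k)) (fun k _ => (Real.exp_pos _).le)
      (Finset.mem_univ i)
  have hpos : 0 < ∑ k, Real.exp (p k) := (Real.exp_pos _).trans_le hle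
  simp only [softmax, ← sub_div]
  refine ⟨div_pos (sub_pos.mpr (Real.exp_lt_exp.mpr hij)) hpos, ?_⟩
  rw [div_lt_iff₀ hpos]
  exact (exp_sub_exp_lt_mul_exp hij).trans_le
    (mul_le_mul_of_nonneg_left hle (sub_pos.mpr hij).le)
end

section
/- Let K ≥ 2 and let p : Fin K → ℝ be a probability vector (0 ≤ p i, ∑ i, p i = 1) that is not uniform (there exists i with p i ≠ 1/K). Let q = softmax(p). Then H(q) > H(p), where H(p) = -∑ i, p i · Real.log (p i) is the Shannon entropy (with the convention 0 · log 0 = 0). -/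
noncomputable def shannonEntropy {K : ℕ} (p : Fin K → ℝ) : ℝ :=
  -∑ i, p i * Real.log (p i)

theorem sum_softmax {K : ℕ} (z : Fin K → ℝ) (hZ : 0 < ∑ j, Real.exp (z j)) :
    ∑ i, softmax z i = 1 := by
  simp only [softmax, ← Finset.sum_div]
  exact div_self (ne_of_gt hZ)

/-- The strict pointwise bound behind the Gibbs inequality. -/
theorem mul_log_sub_mul_log_lt {a b : ℝ} (ha : 0 ≤ a) (hb : 0 < b) (hab : a ≠ b) :
    a * Real.log b - a * Real.log a < b - a := by
  rcases ha.eq_or_lt with rfl | ha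
  · simpa using hb
  · have h := Real.log_lt_sub_one_of_pos (div_pos hb ha)
      (fun h => hab ((div_eq_one_iff_eq ha.ne').1 h).symm)
    rw [Real.log_div hb.ne' ha.ne'] at h
    have h' := mul_lt_mul_of_pos_left h ha
    have e : a * (b / a - 1) = b - a := by field_simp
    linarith

/-- The Gibbs inequality: entropy is smaller than cross entropy for distinct distributions. -/
theorem shannonEntropy_lt_cross {K : ℕ} {p q : Fin K → ℝ} (hp : ∀ i, 0 ≤ p i)
    (hq : ∀ i, 0 < q i) (hsum : ∑ i, p i = ∑ i, q i) (hne : p ≠ q) :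
    shannonEntropy p < -∑ i, p i * Real.log (q i) := by
  obtain ⟨i, hi⟩ := Function.ne_iff.1 hne
  have h : ∑ i, (p i * Real.log (q i) - p i * Real.log (p i)) < ∑ i, (q i - p i) := by
    refine Finset.sum_lt_sum (fun j _ => ?_)
      ⟨i, Finset.mem_univ i, mul_log_sub_mul_log_lt (hp i) (hq i) hi⟩
    by_cases hj : p j = q j
    · simp [hj]
    · exact (mul_log_sub_mul_log_lt (hp j) (hq j) hj).le
  rw [Finset.sum_sub_distrib, Finset.sum_sub_distrib] at h
  unfold shannonEntropy
  linarith

theorem exp_sub_mul_lt {Z a b : ℝ} (hab : a < b) (hb : Real.exp b ≤ Z) :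
    Real.exp b - Z * b < Real.exp a - Z * a := by
  have h := Real.add_one_lt_exp (sub_neg.2 hab).ne
  have h' := mul_lt_mul_of_pos_left h (Real.exp_pos b)
  rw [← Real.exp_add, add_sub_cancel] at h'
  nlinarith [mul_le_mul_of_nonneg_right hb (sub_pos.2 hab).le]

theorem exp_le_sum_exp {K : ℕ} (z : Fin K → ℝ) (i : Fin K) :
    Real.exp (z i) ≤ ∑ j, Real.exp (z j) :=
  Finset.single_le_sum (f := fun j => Real.exp (z j)) (fun _ _ => (Real.exp_pos _).le)
    (Finset.mem_univ i)

theorem sum_softmax_mul_le {K : ℕ} (p : Fin K → ℝ) (hsum : ∑ i, p i = 1)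
    (hZ : 0 < ∑ j, Real.exp (p j)) (hK : 0 < K) :
    ∑ i, softmax p i * p i ≤ ∑ i, p i * p i := by
  have hanti : Antivary (fun i => Real.exp (p i) - (∑ j, Real.exp (p j)) * p i) p :=
    fun i j hij => (exp_sub_mul_lt hij (exp_le_sum_exp p j)).le
  have h := hanti.card_mul_sum_le_sum_mul_sum
  rw [Finset.sum_sub_distrib, ← Finset.mul_sum, hsum, mul_one, mul_one, sub_self] at h
  have hK' : (0 : ℝ) < Fintype.card (Fin K) := by simpa using hK
  have h' := nonpos_of_mul_nonpos_right h hK'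
  simp only [sub_mul, Finset.sum_sub_distrib, mul_assoc, ← Finset.mul_sum] at h'
  simp only [softmax, div_mul_eq_mul_div, ← Finset.sum_div]
  rw [div_le_iff₀ hZ]
  linarith

theorem eq_of_eq_softmax {K : ℕ} {p : Fin K → ℝ} (h : p = softmax p) (i j : Fin K) :
    p i = p j := by
  have key (i : Fin K) : Real.exp (p i) - (∑ j, Real.exp (p j)) * p i = 0 := by
    have hZ := (Real.exp_pos (p i)).trans_le (exp_le_sum_exp p i)
    have hi : p i = Real.exp (p i) / ∑ j, Real.exp (p j) := congrFun h i
    rw [eq_div_iff hZ.ne'] at hi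
    linarith
  by_contra hne
  rcases lt_or_gt_of_ne hne with hlt | hlt
  · linarith [exp_sub_mul_lt hlt (exp_le_sum_exp p j), key i, key j]
  · linarith [exp_sub_mul_lt hlt (exp_le_sum_exp p i), key i, key j]

theorem entropy_resoftmax_gt (K : ℕ) (hK : 2 ≤ K) (p : Fin K → ℝ)
    (hp : ∀ i, 0 ≤ p i) (hsum : ∑ i, p i = 1)
    (hnu : ∃ i, p i ≠ 1 / (K : ℝ))
    (q : Fin K → ℝ) (hq : q = softmax p) :
    shannonEntropy q > shannonEntropy p := by
  obtain ⟨i, hi⟩ := hnu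
  have hZ := (Real.exp_pos (p i)).trans_le (exp_le_sum_exp p i)
  have hK0 : (K : ℝ) ≠ 0 := by positivity
  have hne : p ≠ q := by
    rintro rfl
    apply hi
    rw [Finset.sum_congr rfl fun j _ => eq_of_eq_softmax hq j i] at hsum
    rw [eq_div_iff hK0, mul_comm]
    simpa using hsum
  subst hq
  have hlog (j : Fin K) : Real.log (softmax p j) = p j - Real.log (∑ j, Real.exp (p j)) := by
    rw [softmax, Real.log_div (Real.exp_pos _).ne' hZ.ne', Real.log_exp]
  have hqsum := sum_softmax p hZ
  have hgibbs := shannonEntropy_lt_cross hp (fun j => div_pos (Real.exp_pos (p j)) hZ)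
    (hsum.trans hqsum.symm) hne
  refine hgibbs.trans_le ?_
  change -∑ j, p j * Real.log (softmax p j) ≤ _
  simp only [shannonEntropy, hlog, mul_sub, Finset.sum_sub_distrib, ← Finset.sum_mul, hsum, hqsum]
  linarith [sum_softmax_mul_le p hsum hZ (by omega)]
end

section
/- Let K ≥ 2, let p : Fin K → ℝ be a probability vector (0 ≤ p i, ∑ i, p i = 1), and let q = softmax(p). Then for all i, j, q i - q j ≤ (e - 1)/(K - 1 + e), where e = exp 1. -/
theorem exp_add_card_sub_one_le_sum_exp {K : ℕ} {z : Fin K → ℝ} (hz : ∀ i, 0 ≤ z i) (i : Fin K) :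
    Real.exp (z i) + ((K : ℝ) - 1) ≤ ∑ j, Real.exp (z j) := by
  have h := Finset.single_le_sum (f := fun j => Real.exp (z j) - 1)
    (fun j _ => sub_nonneg.2 (Real.one_le_exp (hz j))) (Finset.mem_univ i)
  simp only [Finset.sum_sub_distrib, Finset.sum_const, Finset.card_univ, Fintype.card_fin,
    nsmul_eq_mul, mul_one] at h
  linarith

theorem resoftmax_spread_bound (K : ℕ) (hK : 2 ≤ K) (p : Fin K → ℝ)
    (hp : ∀ i, 0 ≤ p i) (hsum : ∑ i, p i = 1)
    (q : Fin K → ℝ) (hq : q = softmax p) :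
    ∀ i j, q i - q j ≤ (Real.exp 1 - 1) / ((K : ℝ) - 1 + Real.exp 1) := by
  intro i j
  have hK' : (2 : ℝ) ≤ K := by exact_mod_cast hK
  have hi : p i ≤ 1 := hsum ▸ Finset.single_le_sum (fun k _ => hp k) (Finset.mem_univ i)
  have hie : Real.exp (p i) ≤ Real.exp 1 := Real.exp_le_exp.2 hi
  have hi1 : 1 ≤ Real.exp (p i) := Real.one_le_exp (hp i)
  have hj1 : 1 ≤ Real.exp (p j) := Real.one_le_exp (hp j)
  have hS := exp_add_card_sub_one_le_sum_exp hp i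
  subst hq
  simp only [softmax]
  rw [← sub_div]
  calc (Real.exp (p i) - Real.exp (p j)) / ∑ k, Real.exp (p k)
      ≤ (Real.exp (p i) - 1) / ∑ k, Real.exp (p k) := by gcongr
    _ ≤ (Real.exp (p i) - 1) / (Real.exp (p i) + ((K : ℝ) - 1)) :=
        div_le_div_of_nonneg_left (by linarith) (by linarith) hS
    _ ≤ (Real.exp 1 - 1) / ((K : ℝ) - 1 + Real.exp 1) := by
        rw [div_le_div_iff₀ (by linarith) (by linarith)]
        nlinarith [mul_le_mul_of_nonneg_left hie (Nat.cast_nonneg (α := ℝ) K)]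
end
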